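/- arXiv:0706.2707 — 2 statements merged into one kernel-verified Lean document; each statement's English description precedes it below -/
import Mathlib

section
/- For n ≥ 3 and any prime p, the element x = B̄_{[1,n−1]} − B̄_{[n−1,1]} of Σ(n,p) lies in the Jacobson radical R(n,p) and satisfies x^{n−2} ≠ 0; indeed x^r = Σ_{k=0}^{r} (−1)^k C(r,k) B̄_{[1^{r−k}, n−r, 1^{k}]} for 0 ≤ r ≤ n−2, where [1^{a}, n−a−b, 1^{b}] denotes the composition consisting of a ones, then n−a−b, then b ones. -/
open scoped Classical

set_option synthInstance.maxHeartbeats 1000000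
set_option maxHeartbeats 1000000

noncomputable section

/-- The group algebra `F_p[S_n]`. -/
abbrev GroupAlg (n p : ℕ) : Type := MonoidAlgebra (ZMod p) (Equiv.Perm (Fin n))

/-- The descent set of a permutation `σ` of `{1,…,n}` (1-based positions):
`k ∈ {1,…,n-1}` is a descent if `σ(k) > σ(k+1)`.  (With 0-based `Fin n` indices this
compares the images at indices `k-1` and `k`.) -/
def descSet {n : ℕ} (σ : Equiv.Perm (Fin n)) : Set ℕ :=
  {k | ∃ h : k < n, 0 < k ∧ σ ⟨k, h⟩ < σ ⟨k - 1, by omega⟩}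

/-- The set of proper partial sums `{a_1, a_1+a_2, …, a_1+⋯+a_{s-1}}` of a composition. -/
def properPartialSums {n : ℕ} (q : Composition n) : Set ℕ :=
  {m | ∃ i : ℕ, 0 < i ∧ i < q.length ∧ m = q.sizeUpTo i}

/-- `B̄_q`: the sum of all permutations whose descent set is contained in the set of
proper partial sums of `q`. -/
def Bel (n p : ℕ) (q : Composition n) : GroupAlg n p :=
  ∑ σ ∈ Finset.univ.filter
      (fun σ : Equiv.Perm (Fin n) => descSet σ ⊆ properPartialSums q),
    MonoidAlgebra.of (ZMod p) (Equiv.Perm (Fin n)) σ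

/-- The p-modular descent algebra `Σ(n,p)`, as a subalgebra of the group algebra. -/
def descentAlgebra (n p : ℕ) : Subalgebra (ZMod p) (GroupAlg n p) :=
  Algebra.adjoin (ZMod p) (Set.range (Bel n p))

/-- `B̄_q` as an element of `Σ(n,p)`. -/
def BelS (n p : ℕ) (q : Composition n) : descentAlgebra n p :=
  ⟨Bel n p q, Algebra.subset_adjoin ⟨q, rfl⟩⟩

/-- The Jacobson radical `R(n,p)` of `Σ(n,p)`. -/
def descentRadical (n p : ℕ) : Ideal (descentAlgebra n p) :=
  (⊥ : Ideal (descentAlgebra n p)).jacobson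

/-- `R(n,p)` viewed as an `F_p`-subspace of the group algebra. -/
def descentRadicalSubmodule (n p : ℕ) : Submodule (ZMod p) (GroupAlg n p) :=
  Submodule.map (descentAlgebra n p).val.toLinearMap
    ((descentRadical n p).restrictScalars (ZMod p))

/-- `Y_m`: the span of the `B̄_q` with `q` having at least `m` components. -/
def Ysub (n p m : ℕ) : Submodule (ZMod p) (GroupAlg n p) :=
  Submodule.span (ZMod p) {x | ∃ q : Composition n, m ≤ q.length ∧ x = Bel n p q}

/-- `T`: the span of all differences `B̄_q - B̄_r` with `q ≈ r`. -/
def Tsub (n p : ℕ) : Submodule (ZMod p) (GroupAlg n p) :=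
  Submodule.span (ZMod p)
    {x | ∃ q r : Composition n, q.blocks.Perm r.blocks ∧ x = Bel n p q - Bel n p r}

/-- `g(n,p)`: the number of partitions of `n` with no part divisible by `p`. -/
def gPart (n p : ℕ) : ℕ := Set.ncard {π : n.Partition | ∀ i ∈ π.parts, ¬ p ∣ i}

/-- `g(n,p)`: the number of conjugacy classes of `p`-regular elements of `S_n`. -/
def gReg (n p : ℕ) : ℕ :=
  Set.ncard {c : ConjClasses (Equiv.Perm (Fin n)) | ∀ σ ∈ c.carrier, (orderOf σ).Coprime p}

/-- The Young character `χ_q`: `χ_q(σ)` is the number of ordered set partitions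
`(P_1,…,P_s)` of `{1,…,n}` with `|P_i| = a_i`, each of whose blocks is `σ`-invariant. -/
def youngChar {n : ℕ} (q : Composition n) (σ : Equiv.Perm (Fin n)) : ℕ :=
  (Finset.univ.filter (fun P : Fin q.length → Finset (Fin n) =>
    (∀ i, (P i).card = q.blocksFun i) ∧
    (∀ i j, i ≠ j → Disjoint (P i) (P j)) ∧
    (∀ x, ∃ i, x ∈ P i) ∧
    (∀ i, ∀ x ∈ P i, σ x ∈ P i))).card

/-- `χ̃_q`: the Young character with values reduced mod `p`. -/
def youngCharMod (n p : ℕ) (q : Composition n) : Equiv.Perm (Fin n) → ZMod p :=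
  fun σ => (youngChar q σ : ZMod p)

/-- `G(n,p)`: the span of the mod-`p` Young characters. -/
def Gnp (n p : ℕ) : Submodule (ZMod p) (Equiv.Perm (Fin n) → ZMod p) :=
  Submodule.span (ZMod p) (Set.range (youngCharMod n p))

/-- `S(q,r)`: matrices with row sums `q` and column sums `r`. -/
def SMat {n : ℕ} (q r : Composition n) : Set (Matrix (Fin q.length) (Fin r.length) ℕ) :=
  {Z | (∀ i, ∑ j, Z i j = q.blocksFun i) ∧ (∀ j, ∑ i, Z i j = r.blocksFun j)}

/-- `w(Z)`: the list of nonzero entries of `Z` read row by row. -/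
def wList {s t : ℕ} (Z : Matrix (Fin s) (Fin t) ℕ) : List ℕ :=
  ((List.finRange s).flatMap fun i => ((List.finRange t).map fun j => Z i j)).filter
    (fun x => x ≠ 0)

/-- One merging step: replace two adjacent components by their sum. -/
def mergeStep (l l' : List ℕ) : Prop :=
  ∃ (u v : List ℕ) (a b : ℕ), l = u ++ a :: b :: v ∧ l' = u ++ (a + b) :: v

/-- `coarsens l l'` (`l ⪯ l'` on compositions): `l'` is obtained from `l` by repeatedly
replacing adjacent components by their sum. -/
def coarsens (l l' : List ℕ) : Prop := Relation.ReflTransGen mergeStep l l'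

/-- The composition `[1^a, n-a-b, 1^b]`. -/
def compD (n a b : ℕ) (h : a + b + 1 ≤ n) : Composition n :=
  ⟨List.replicate a 1 ++ (n - a - b) :: List.replicate b 1,
    by
      intro i hi
      simp only [List.mem_append, List.mem_replicate, List.mem_cons] at hi
      rcases hi with h1 | h1 | h1 <;> omega,
    by
      simp [List.sum_replicate]
      omega⟩

/-- The word `w` is increasing on the positions `a, …, e - 1`. -/
def IncreasingOn {n : ℕ} (a e : ℕ) (w : Equiv.Perm (Fin n)) : Prop :=
  ∀ i j : Fin n, a ≤ i.val → i < j → j.val < e → w i < w j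

/-- The sum of all words that are increasing on the positions `a, …, e - 1`. -/
def increasingSum (n p a e : ℕ) : GroupAlg n p :=
  ∑ w ∈ Finset.univ.filter (fun w : Equiv.Perm (Fin n) => IncreasingOn a e w),
    MonoidAlgebra.of (ZMod p) (Equiv.Perm (Fin n)) w

lemma lt_of_forall_notMem_descSet {n : ℕ} (σ : Equiv.Perm (Fin n)) (i j : Fin n) (hij : i < j)
    (h : ∀ k : ℕ, i.val < k → k ≤ j.val → k ∉ descSet σ) : σ i < σ j := by
  obtain ⟨j, hj⟩ := j
  induction j with
  | zero => exact absurd hij (by simp [Fin.lt_def])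
  | succ j ih =>
    have hij' : i.val < j + 1 := hij
    have hstep : σ ⟨j, by omega⟩ < σ ⟨j + 1, hj⟩ := by
      have hd := h (j + 1) hij' le_rfl
      have hle : σ ⟨j, by omega⟩ ≤ σ ⟨j + 1, hj⟩ := by
        by_contra hlt
        exact hd ⟨hj, by omega, by simpa using hlt⟩
      refine lt_of_le_of_ne hle fun he => ?_
      have := σ.injective he
      simp at this
    rcases Nat.lt_succ_iff_lt_or_eq.1 hij' with hlt | heq
    · exact (ih (by omega) hlt fun k h1 h2 => h k h1 (by simp at h2 ⊢; omega)).trans hstep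
    · have : i = ⟨j, by omega⟩ := Fin.ext heq
      rwa [this]

lemma properPartialSums_compD (n a b : ℕ) (h : a + b + 1 ≤ n) :
    properPartialSums (compD n a b h) = {m | (0 < m ∧ m ≤ a) ∨ (n - b ≤ m ∧ m < n)} := by
  have hlen : (compD n a b h).length = a + b + 1 := by
    simp [compD, Composition.length]; omega
  have hsum : ∀ i, i ≤ a + b → (compD n a b h).sizeUpTo i =
      if i ≤ a then i else n - b + (i - a - 1) := by
    intro i hi
    simp only [compD, Composition.sizeUpTo, List.take_append, List.length_replicate,
      List.take_replicate, List.sum_append, List.sum_replicate, smul_eq_mul, mul_one]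
    split_ifs with hia
    · simp [Nat.sub_eq_zero_of_le hia, hia]
    · obtain ⟨c, rfl⟩ : ∃ c, i = a + (c + 1) := ⟨i - a - 1, by omega⟩
      simp [List.take_replicate]
      omega
  ext m
  simp only [properPartialSums, Set.mem_ofPred_eq, hlen]
  constructor
  · rintro ⟨i, h0, h1, rfl⟩
    rw [hsum i (by omega)]
    split_ifs <;> omega
  · rintro (hm | hm)
    · exact ⟨m, by omega, by omega, by rw [hsum m (by omega), if_pos hm.2]⟩
    · refine ⟨m - (n - b) + a + 1, by omega, by omega, ?_⟩
      rw [hsum _ (by omega), if_neg (by omega)]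
      omega

lemma descSet_subset_iff (n a b : ℕ) (h : a + b + 1 ≤ n) (σ : Equiv.Perm (Fin n)) :
    descSet σ ⊆ properPartialSums (compD n a b h) ↔ IncreasingOn a (n - b) σ := by
  rw [properPartialSums_compD]
  constructor
  · intro hs i j hai hij hj
    refine lt_of_forall_notMem_descSet σ i j hij fun k h1 h2 hk => ?_
    rcases hs hk with hh | hh <;> omega
  · rintro hs k ⟨hk, h0, hlt⟩
    by_contra hc
    simp only [Set.mem_ofPred_eq, not_or, not_and_or] at hc
    exact (hs ⟨k - 1, by omega⟩ ⟨k, hk⟩ (by simp; omega) (Fin.mk_lt_mk.2 (by omega))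
      (by simp; omega)).not_gt hlt

lemma Bel_compD (n p a b : ℕ) (h : a + b + 1 ≤ n) :
    Bel n p (compD n a b h) = increasingSum n p a (n - b) := by
  simp only [Bel, increasingSum, descSet_subset_iff]

lemma sort_inv_lt_iff {n : ℕ} (f : Fin n → ℕ) (x y : Fin n) :
    (Tuple.sort f)⁻¹ x < (Tuple.sort f)⁻¹ y ↔ f x < f y ∨ (f x = f y ∧ x < y) := by
  obtain ⟨hm, ht⟩ := Tuple.eq_sort_iff.1 (rfl : Tuple.sort f = Tuple.sort f)
  have key : ∀ x y, (Tuple.sort f)⁻¹ x < (Tuple.sort f)⁻¹ y →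
      f x < f y ∨ (f x = f y ∧ x < y) := by
    intro x y h
    have h1 := hm h.le
    have h2 := ht _ _ h
    simp only [Function.comp_apply, Equiv.Perm.coe_inv, Equiv.apply_symm_apply] at h1 h2
    rcases h1.lt_or_eq with h3 | h3
    · exact Or.inl h3
    · exact Or.inr ⟨h3, h2 h3⟩
  refine ⟨key x y, fun h => ?_⟩
  by_contra hn
  rcases (not_lt.1 hn).lt_or_eq with h1 | h1
  · have := key y x h1
    omega
  · have := (Tuple.sort f)⁻¹.injective h1
    subst this
    omega

/-- The colouring that singles out the letter `i` as the first block. -/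
def frontColor {n : ℕ} (i : Fin n) : Fin n → ℕ := fun l => if l = i then 0 else 1

/-- The colouring that singles out the letter `i` as the last block. -/
def backColor {n : ℕ} (i : Fin n) : Fin n → ℕ := fun l => if l = i then 1 else 0

lemma sort_frontColor_zero {m : ℕ} (i : Fin (m + 1)) : Tuple.sort (frontColor i) 0 = i := by
  by_contra hne
  have h := (sort_inv_lt_iff (frontColor i) i (Tuple.sort (frontColor i) 0)).2
    (Or.inl (by simp [frontColor, hne]))
  simp at h

lemma sort_backColor_last {m : ℕ} (i : Fin (m + 1)) :
    Tuple.sort (backColor i) (Fin.last m) = i := by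
  by_contra hne
  have h := (sort_inv_lt_iff (backColor i) (Tuple.sort (backColor i) (Fin.last m)) i).2
    (Or.inl (by simp [backColor, hne]))
  simp only [Equiv.Perm.coe_inv, Equiv.symm_apply_apply] at h
  exact absurd (Fin.le_last _) h.not_ge

lemma increasingOn_sort_frontColor {m : ℕ} (i : Fin (m + 1)) :
    IncreasingOn 1 (m + 1) (Tuple.sort (frontColor i)) := by
  intro x y hx hxy _
  have hne : ∀ z : Fin (m + 1), 1 ≤ z.val → Tuple.sort (frontColor i) z ≠ i := by
    intro z hz h
    have := (Tuple.sort (frontColor i)).injective (h.trans (sort_frontColor_zero i).symm)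
    simp [this] at hz
  refine (Tuple.eq_sort_iff.1 (rfl : Tuple.sort (frontColor i) = _)).2 x y hxy ?_
  simp [frontColor, hne x hx, hne y (hx.trans hxy.le)]

lemma increasingOn_sort_backColor {m : ℕ} (i : Fin (m + 1)) :
    IncreasingOn 0 m (Tuple.sort (backColor i)) := by
  intro x y _ hxy hy
  have hne : ∀ z : Fin (m + 1), z.val < m → Tuple.sort (backColor i) z ≠ i := by
    intro z hz h
    have := (Tuple.sort (backColor i)).injective (h.trans (sort_backColor_last i).symm)
    simp [this] at hz
  refine (Tuple.eq_sort_iff.1 (rfl : Tuple.sort (backColor i) = _)).2 x y hxy ?_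
  simp [backColor, hne y hy, hne x (lt_trans (Fin.lt_def.1 hxy) hy)]

lemma eq_sort_frontColor {m : ℕ} (w : Equiv.Perm (Fin (m + 1))) (hw : IncreasingOn 1 (m + 1) w) :
    w = Tuple.sort (frontColor (w 0)) := by
  refine Tuple.eq_sort_iff.2 ⟨fun x y hxy => ?_, fun x y hxy h => ?_⟩
  · simp only [Function.comp_apply, frontColor, w.injective.eq_iff]
    split_ifs <;> simp_all
  · simp only [frontColor, w.injective.eq_iff] at h
    refine hw x y (Nat.one_le_iff_ne_zero.2 fun h0 => ?_) hxy y.isLt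
    obtain rfl : x = 0 := Fin.ext h0
    simp [hxy.ne'] at h

lemma eq_sort_backColor {m : ℕ} (w : Equiv.Perm (Fin (m + 1))) (hw : IncreasingOn 0 m w) :
    w = Tuple.sort (backColor (w (Fin.last m))) := by
  refine Tuple.eq_sort_iff.2 ⟨fun x y hxy => ?_, fun x y hxy h => ?_⟩
  · simp only [Function.comp_apply, backColor, w.injective.eq_iff]
    split_ifs <;> simp_all
  · simp only [backColor, w.injective.eq_iff] at h
    refine hw x y (Nat.zero_le _) hxy (lt_of_le_of_ne (Nat.le_of_lt_succ y.isLt) fun h0 => ?_)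
    obtain rfl : y = Fin.last m := Fin.ext h0
    simp [hxy.ne] at h

lemma increasingSum_front (m p : ℕ) :
    increasingSum (m + 1) p 1 (m + 1) =
      ∑ i, MonoidAlgebra.of (ZMod p) (Equiv.Perm (Fin (m + 1))) (Tuple.sort (frontColor i)) :=
  Finset.sum_bij' (fun w _ => w 0) (fun i _ => Tuple.sort (frontColor i))
    (fun _ _ => Finset.mem_univ _)
    (fun i _ => Finset.mem_filter.2 ⟨Finset.mem_univ _, increasingOn_sort_frontColor i⟩)
    (fun w hw => (eq_sort_frontColor w (Finset.mem_filter.1 hw).2).symm)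
    (fun i _ => sort_frontColor_zero i)
    (fun w hw => congrArg _ (eq_sort_frontColor w (Finset.mem_filter.1 hw).2))

lemma increasingSum_back (m p : ℕ) :
    increasingSum (m + 1) p 0 m =
      ∑ i, MonoidAlgebra.of (ZMod p) (Equiv.Perm (Fin (m + 1))) (Tuple.sort (backColor i)) :=
  Finset.sum_bij' (fun w _ => w (Fin.last m)) (fun i _ => Tuple.sort (backColor i))
    (fun _ _ => Finset.mem_univ _)
    (fun i _ => Finset.mem_filter.2 ⟨Finset.mem_univ _, increasingOn_sort_backColor i⟩)
    (fun w hw => (eq_sort_backColor w (Finset.mem_filter.1 hw).2).symm)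
    (fun i _ => sort_backColor_last i)
    (fun w hw => congrArg _ (eq_sort_backColor w (Finset.mem_filter.1 hw).2))

lemma sum_sort_mul_increasingSum {n : ℕ} (p a e : ℕ) (f : Fin n → Fin n → ℕ) :
    (∑ i, MonoidAlgebra.of (ZMod p) (Equiv.Perm (Fin n)) (Tuple.sort (f i))) *
        increasingSum n p a e =
      ∑ w : Equiv.Perm (Fin n), ∑ q : Fin n,
        if IncreasingOn a e ((Tuple.sort (f (w q)))⁻¹ * w) then
          MonoidAlgebra.of (ZMod p) (Equiv.Perm (Fin n)) w else 0 := by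
  have hw : ∀ w : Equiv.Perm (Fin n), (∑ q : Fin n,
        if IncreasingOn a e ((Tuple.sort (f (w q)))⁻¹ * w) then
          MonoidAlgebra.of (ZMod p) (Equiv.Perm (Fin n)) w else 0) = ∑ i : Fin n,
        if IncreasingOn a e ((Tuple.sort (f i))⁻¹ * w) then
          MonoidAlgebra.of (ZMod p) (Equiv.Perm (Fin n)) w else 0 := fun w =>
    Equiv.sum_comp w fun i => if IncreasingOn a e ((Tuple.sort (f i))⁻¹ * w) then
          MonoidAlgebra.of (ZMod p) (Equiv.Perm (Fin n)) w else 0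
  simp only [hw]
  rw [Finset.sum_comm, Finset.sum_mul]
  refine Finset.sum_congr rfl fun i _ => ?_
  rw [increasingSum, Finset.sum_filter, Finset.mul_sum]
  refine (Finset.sum_congr rfl fun τ _ => ?_).trans (Equiv.sum_comp
    (Equiv.mulLeft (Tuple.sort (f i))) fun w =>
      if IncreasingOn a e ((Tuple.sort (f i))⁻¹ * w) then
        MonoidAlgebra.of (ZMod p) (Equiv.Perm (Fin n)) w else 0)
  simp only [Equiv.coe_mulLeft, inv_mul_cancel_left, map_mul, mul_ite, mul_zero]

lemma increasingOn_sort_inv_mul {n : ℕ} (a e : ℕ) (f : Fin n → ℕ) (w : Equiv.Perm (Fin n)) :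
    IncreasingOn a e ((Tuple.sort f)⁻¹ * w) ↔ ∀ i j : Fin n, a ≤ i.val → i < j → j.val < e →
      f (w i) < f (w j) ∨ (f (w i) = f (w j) ∧ w i < w j) := by
  simp only [IncreasingOn, Equiv.Perm.mul_apply, sort_inv_lt_iff]

lemma increasingOn_front_iff {n : ℕ} (a e : ℕ) (w : Equiv.Perm (Fin n)) (q : Fin n) :
    IncreasingOn a e ((Tuple.sort (frontColor (w q)))⁻¹ * w) ↔
      if a ≤ q.val ∧ q.val < e then q.val = a ∧ IncreasingOn (a + 1) e w
      else IncreasingOn a e w := by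
  rw [increasingOn_sort_inv_mul]
  simp only [frontColor, w.injective.eq_iff]
  split_ifs with hq
  · constructor
    · intro h
      have hqa : q.val = a := by
        by_contra hne
        have := h ⟨a, by omega⟩ q le_rfl (Fin.lt_def.2 (by simp; omega)) hq.2
        have hne' : (⟨a, by omega⟩ : Fin n) ≠ q := fun h => hne (Fin.ext_iff.1 h).symm
        simp [hne'] at this
      refine ⟨hqa, fun i j hi hij hj => ?_⟩
      have := h i j (by omega) hij hj
      rw [if_neg (by rintro rfl; omega), if_neg (by rintro rfl; omega)] at this
      simpa using this
    · rintro ⟨hqa, h⟩ i j hi hij hj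
      have hjq : j ≠ q := by rintro rfl; omega
      rw [if_neg hjq]
      by_cases hiq : i = q
      · simp [hiq]
      · simpa [hiq] using h i j (by have := Fin.val_ne_of_ne hiq; omega) hij hj
  · refine forall₅_congr fun i j hi hij hj => ?_
    have hiq : i ≠ q := by rintro rfl; omega
    have hjq : j ≠ q := by rintro rfl; omega
    simp [hiq, hjq]

lemma increasingOn_back_iff {n : ℕ} (a e : ℕ) (w : Equiv.Perm (Fin n)) (q : Fin n) (he : e ≤ n) :
    IncreasingOn a e ((Tuple.sort (backColor (w q)))⁻¹ * w) ↔
      if a ≤ q.val ∧ q.val < e then q.val = e - 1 ∧ IncreasingOn a (e - 1) w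
      else IncreasingOn a e w := by
  rw [increasingOn_sort_inv_mul]
  simp only [backColor, w.injective.eq_iff]
  split_ifs with hq
  · constructor
    · intro h
      have hqa : q.val = e - 1 := by
        by_contra hne
        have := h q ⟨e - 1, by omega⟩ hq.1 (Fin.lt_def.2 (by simp; omega)) (by simp; omega)
        have hne' : (⟨e - 1, by omega⟩ : Fin n) ≠ q := fun h => hne (Fin.ext_iff.1 h).symm
        simp [hne'] at this
      refine ⟨hqa, fun i j hi hij hj => ?_⟩
      have := h i j (by omega) hij (by omega)
      rw [if_neg (by rintro rfl; omega), if_neg (by rintro rfl; omega)] at this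
      simpa using this
    · rintro ⟨hqa, h⟩ i j hi hij hj
      have hiq : i ≠ q := by rintro rfl; omega
      rw [if_neg hiq]
      by_cases hjq : j = q
      · simp [hjq]
      · simpa [hjq] using h i j hi hij (by have := Fin.val_ne_of_ne hjq; omega)
  · refine forall₅_congr fun i j hi hij hj => ?_
    have hiq : i ≠ q := by rintro rfl; omega
    have hjq : j ≠ q := by rintro rfl; omega
    simp [hiq, hjq]

/-- Left multiplication by `B̄_{[1,m]} - B̄_{[m,1]}` splits a letter off either end of the
increasing block. -/
lemma front_sub_back_mul (m p a e : ℕ) (hae : a < e) (he : e ≤ m + 1) :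
    (increasingSum (m + 1) p 1 (m + 1) - increasingSum (m + 1) p 0 m) *
        increasingSum (m + 1) p a e =
      increasingSum (m + 1) p (a + 1) e - increasingSum (m + 1) p a (e - 1) := by
  rw [increasingSum_front, increasingSum_back, sub_mul, sum_sort_mul_increasingSum,
    sum_sort_mul_increasingSum, increasingSum, increasingSum, Finset.sum_filter,
    Finset.sum_filter, ← Finset.sum_sub_distrib, ← Finset.sum_sub_distrib]
  refine Finset.sum_congr rfl fun w _ => ?_
  set W := MonoidAlgebra.of (ZMod p) (Equiv.Perm (Fin (m + 1))) w
  have key : ∀ q : Fin (m + 1),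
      ((if IncreasingOn a e ((Tuple.sort (frontColor (w q)))⁻¹ * w) then W else 0) -
        if IncreasingOn a e ((Tuple.sort (backColor (w q)))⁻¹ * w) then W else 0) =
      (if q = ⟨a, by omega⟩ then (if IncreasingOn (a + 1) e w then W else 0) else 0) -
        if q = ⟨e - 1, by omega⟩ then (if IncreasingOn a (e - 1) w then W else 0) else 0 := by
    intro q
    simp only [increasingOn_front_iff, increasingOn_back_iff a e w q he, Fin.ext_iff]
    by_cases hq : a ≤ q.val ∧ q.val < e
    · simp only [if_pos hq, ite_and]
    · rw [if_neg (show ¬ q.val = a by omega), if_neg (show ¬ q.val = e - 1 by omega)]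
      simp only [if_neg hq, sub_self]
  rw [← Finset.sum_sub_distrib, Finset.sum_congr rfl fun q _ => key q, Finset.sum_sub_distrib]
  simp

lemma increasingSum_zero (n p : ℕ) : increasingSum n p 0 n = 1 := by
  have h : ∀ w : Equiv.Perm (Fin n), IncreasingOn 0 n w ↔ w = 1 := by
    refine fun w => ⟨fun hw => ?_, ?_⟩
    · have hmono : StrictMono w := fun i j hij => hw i j (Nat.zero_le _) hij j.isLt
      exact Equiv.coe_fn_injective (le_antisymm hmono.le_id hmono.id_le)
    · rintro rfl i j _ hij _
      exact hij
  simp only [increasingSum, h, Finset.filter_eq', Finset.mem_univ, if_true, Finset.sum_singleton,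
    map_one]

lemma front_sub_back_pow (m p r : ℕ) (hr : r ≤ m) :
    (increasingSum (m + 1) p 1 (m + 1) - increasingSum (m + 1) p 0 m) ^ r =
      ∑ ij ∈ Finset.HasAntidiagonal.antidiagonal r, r.choose ij.1 •
        ((-1 : ZMod p) ^ ij.1 • increasingSum (m + 1) p ij.2 (m + 1 - ij.1)) := by
  induction r with
  | zero => simp [increasingSum_zero]
  | succ r ih =>
    rw [pow_succ', ih (by omega), Finset.mul_sum, Finset.sum_antidiagonal_choose_succ_nsmul
      (fun i j => (-1 : ZMod p) ^ i • increasingSum (m + 1) p j (m + 1 - i)),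
      ← Finset.sum_add_distrib]
    refine Finset.sum_congr rfl fun ij hij => ?_
    rw [Finset.HasAntidiagonal.mem_antidiagonal] at hij
    rw [Nat.choose_symm_of_eq_add (hij.symm.trans (add_comm _ _)), mul_smul_comm, mul_smul_comm,
      front_sub_back_mul m p _ _ (by omega) (by omega), ← smul_add, pow_succ, mul_neg_one,
      neg_smul, smul_sub, sub_eq_add_neg, Nat.sub_sub]

lemma increasingSum_coeff (n p a e : ℕ) (w : Equiv.Perm (Fin n)) :
    (increasingSum n p a e).coeff w = if IncreasingOn a e w then 1 else 0 := by
  simp [increasingSum, MonoidAlgebra.coeff_sum, MonoidAlgebra.of_apply, Finsupp.finsetSum_apply,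
    Finsupp.single_apply, Finset.sum_ite_eq']

lemma front_sub_back_pow_ne_zero (m p : ℕ) (hm : 2 ≤ m) (hp : p.Prime) :
    (increasingSum (m + 1) p 1 (m + 1) - increasingSum (m + 1) p 0 m) ^ (m - 1) ≠ 0 := by
  have := Fact.mk hp
  rw [front_sub_back_pow m p _ (by omega)]
  intro h
  set w : Equiv.Perm (Fin (m + 1)) := Equiv.neg (Fin (m + 1))
  have hw : ∀ ij ∈ Finset.HasAntidiagonal.antidiagonal (m - 1),
      (IncreasingOn ij.2 (m + 1 - ij.1) w ↔ ij = (m - 1, 0)) := by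
    rintro ⟨i, j⟩ hij
    rw [Finset.HasAntidiagonal.mem_antidiagonal] at hij
    simp only [Prod.mk.injEq] at hij ⊢
    constructor
    · intro hinc
      have hlt := hinc ⟨j, by omega⟩ ⟨j + 1, by omega⟩ le_rfl (Fin.mk_lt_mk.2 (by omega))
        (by simp; omega)
      simp only [w, Equiv.neg_apply, Fin.lt_def, Fin.val_neg, Fin.ext_iff, Fin.val_zero] at hlt
      split_ifs at hlt <;> omega
    · rintro ⟨rfl, rfl⟩ x y _ hxy hy
      simp only [w, Equiv.neg_apply, Fin.lt_def, Fin.val_neg, Fin.ext_iff, Fin.val_zero] at hxy ⊢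
      split_ifs <;> omega
  have h0 := congrArg (fun y => y.coeff w) h
  simp only [MonoidAlgebra.coeff_sum, Finsupp.finsetSum_apply,
    MonoidAlgebra.coeff_smul, Finsupp.smul_apply, increasingSum_coeff, MonoidAlgebra.coeff_zero,
    Finsupp.zero_apply] at h0
  rw [Finset.sum_congr rfl fun ij hij => by rw [if_congr (hw ij hij) rfl rfl]] at h0
  simp at h0

/-- The colouring of positions by blocks, a new block starting after each element of `S`. -/
def blockColor {n : ℕ} (S : Set ℕ) : Fin n → ℕ :=
  fun i => ((Finset.Icc 1 i.val).filter (· ∈ S)).card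

lemma blockColor_mono {n : ℕ} (S : Set ℕ) : Monotone (blockColor S : Fin n → ℕ) :=
  fun _ _ hij => Finset.card_le_card
    (Finset.filter_subset_filter _ (Finset.Icc_subset_Icc_right hij))

lemma notMem_of_blockColor_eq {n : ℕ} {S : Set ℕ} {i j : Fin n} (hij : i ≤ j)
    (h : blockColor S i = blockColor S j) (k : ℕ) (hik : i.val < k) (hkj : k ≤ j.val) :
    k ∉ S := by
  intro hk
  have heq := Finset.eq_of_subset_of_card_le
    (Finset.filter_subset_filter (· ∈ S) (Finset.Icc_subset_Icc_right (a := 1) hij)) h.ge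
  have : k ∈ (Finset.Icc 1 i.val).filter (· ∈ S) := by
    rw [heq]
    simp only [Finset.mem_filter, Finset.mem_Icc]
    exact ⟨⟨by omega, hkj⟩, hk⟩
  simp only [Finset.mem_filter, Finset.mem_Icc] at this
  omega

lemma sort_blockColor {n : ℕ} {S : Set ℕ} (σ : Equiv.Perm (Fin n)) (hσ : descSet σ ⊆ S) :
    Tuple.sort (blockColor S ∘ ⇑σ⁻¹) = σ := by
  symm
  refine Tuple.eq_sort_iff.2 ⟨?_, fun i j hij h => ?_⟩
  · have : (blockColor S ∘ ⇑σ⁻¹) ∘ ⇑σ = blockColor S := by ext; simp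
    rw [this]
    exact blockColor_mono S
  · simp only [Function.comp_apply, Equiv.Perm.coe_inv, Equiv.symm_apply_apply] at h
    exact lt_of_forall_notMem_descSet σ i j hij fun k h1 h2 hk =>
      notMem_of_blockColor_eq hij.le h k h1 h2 (hσ hk)

lemma comp_sort_blockColor {n : ℕ} (S : Set ℕ) (τ : Equiv.Perm (Fin n)) :
    (blockColor S ∘ ⇑τ⁻¹) ∘ Tuple.sort (blockColor S ∘ ⇑τ⁻¹) = blockColor S := by
  have h : (blockColor S ∘ ⇑τ⁻¹) ∘ ⇑τ = blockColor S := by ext; simp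
  conv_rhs => rw [← h]
  refine Tuple.unique_monotone (Tuple.monotone_sort _) ?_
  rw [h]
  exact blockColor_mono S

lemma descSet_sort_blockColor {n : ℕ} (S : Set ℕ) (τ : Equiv.Perm (Fin n)) :
    descSet (Tuple.sort (blockColor S ∘ ⇑τ⁻¹)) ⊆ S := by
  rintro k ⟨hk, h0, hlt⟩
  by_contra hkS
  set g : Fin n → ℕ := blockColor S ∘ ⇑τ⁻¹
  have hg : ∀ i, g (Tuple.sort g i) = blockColor S i := congrFun (comp_sort_blockColor S τ)
  refine ((Tuple.eq_sort_iff.1 (rfl : Tuple.sort g = _)).2 ⟨k - 1, by omega⟩ ⟨k, hk⟩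
    (Fin.mk_lt_mk.2 (by omega)) ?_).not_gt hlt
  rw [hg, hg, blockColor, blockColor]
  congr 1
  ext l
  simp only [Finset.mem_filter, Finset.mem_Icc, and_congr_left_iff]
  intro hl
  have : l ≠ k := by rintro rfl; exact hkS hl
  omega

/-- The operator that stably sorts words by the colours of their letters. -/
def sortOp {n : ℕ} (p : ℕ) (f : Fin n → ℕ) : Module.End (ZMod p) (GroupAlg n p) :=
  (MonoidAlgebra.basis (Equiv.Perm (Fin n)) (ZMod p)).constr (ZMod p)
    fun w => MonoidAlgebra.single (w * Tuple.sort (f ∘ w)) 1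

lemma sortOp_single {n : ℕ} (p : ℕ) (f : Fin n → ℕ) (w : Equiv.Perm (Fin n)) :
    sortOp p f (MonoidAlgebra.single w 1) =
      MonoidAlgebra.single (w * Tuple.sort (f ∘ w)) 1 := by
  rw [← MonoidAlgebra.basis_apply, sortOp, Module.Basis.constr_basis]

lemma end_ext {n p : ℕ} {u v : Module.End (ZMod p) (GroupAlg n p)}
    (h : ∀ w : Equiv.Perm (Fin n), u (MonoidAlgebra.single w 1) = v (MonoidAlgebra.single w 1)) :
    u = v :=
  (MonoidAlgebra.basis (Equiv.Perm (Fin n)) (ZMod p)).ext fun w => by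
    rw [MonoidAlgebra.basis_apply]
    exact h w

/-- The lexicographic combination of two colourings. -/
def lexColor {n : ℕ} (h f : Fin n → ℕ) : Fin n → ℕ :=
  fun l => h l * (∑ l', f l' + 1) + f l

lemma lexColor_lt_iff {n : ℕ} (h f : Fin n → ℕ) (x y : Fin n) :
    lexColor h f x < lexColor h f y ↔ h x < h y ∨ (h x = h y ∧ f x < f y) := by
  have hb : ∀ z, f z < ∑ l', f l' + 1 := fun z =>
    Nat.lt_succ_of_le (Finset.single_le_sum (fun _ _ => Nat.zero_le _) (Finset.mem_univ z))
  have hx := hb x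
  have hy := hb y
  simp only [lexColor]
  generalize ∑ l', f l' + 1 = K at *
  rcases lt_trichotomy (h x) (h y) with h1 | h1 | h1
  · have := Nat.mul_le_mul_right K (Nat.succ_le_of_lt h1)
    simp only [h1, true_or, iff_true]
    rw [Nat.succ_mul] at this
    omega
  · rw [h1]; omega
  · have := Nat.mul_le_mul_right K (Nat.succ_le_of_lt h1)
    rw [Nat.succ_mul] at this
    omega

lemma lexColor_eq_iff {n : ℕ} (h f : Fin n → ℕ) (x y : Fin n) :
    lexColor h f x = lexColor h f y ↔ h x = h y ∧ f x = f y := by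
  have h1 := lexColor_lt_iff h f x y
  have h2 := lexColor_lt_iff h f y x
  omega

lemma sort_congr {n : ℕ} {f g : Fin n → ℕ} (h : ∀ x y, f x < f y ↔ g x < g y) :
    Tuple.sort f = Tuple.sort g := by
  obtain ⟨hm, ht⟩ := Tuple.eq_sort_iff.1 (rfl : Tuple.sort f = _)
  refine Tuple.eq_sort_iff.2 ⟨fun i j hij => ?_, fun i j hij he => ht i j hij ?_⟩
  · have := hm hij
    have := h (Tuple.sort f j) (Tuple.sort f i)
    simp only [Function.comp_apply] at *
    omega
  · have := h (Tuple.sort f j) (Tuple.sort f i)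
    have := h (Tuple.sort f i) (Tuple.sort f j)
    omega

lemma sortOp_congr {n p : ℕ} {f g : Fin n → ℕ} (h : ∀ x y, f x < f y ↔ g x < g y) :
    sortOp p f = sortOp p g := by
  refine end_ext fun w => ?_
  rw [sortOp_single, sortOp_single,
    sort_congr (f := f ∘ w) (g := g ∘ w) fun x y => h (w x) (w y)]

lemma sortOp_mul {n p : ℕ} (h f : Fin n → ℕ) :
    sortOp p h * sortOp p f = sortOp p (lexColor h f) := by
  refine end_ext fun w => ?_
  rw [Module.End.mul_apply, sortOp_single, sortOp_single, sortOp_single, mul_assoc]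
  set s := Tuple.sort (f ∘ w) with hs
  set t := Tuple.sort (h ∘ ⇑(w * s)) with ht
  obtain ⟨hsm, hst⟩ := Tuple.eq_sort_iff.1 hs
  obtain ⟨htm, htt⟩ := Tuple.eq_sort_iff.1 ht
  congr 2
  refine Tuple.eq_sort_iff.2 ⟨fun i j hij => ?_, fun i j hij he => ?_⟩
  · rcases hij.eq_or_lt with rfl | hlt
    · exact le_rfl
    · have h1 := htm hij
      have h2 := htt i j hlt
      have h3 : t i < t j → _ := fun hh => hsm hh.le
      simp only [Function.comp_apply, Equiv.Perm.mul_apply] at h1 h2 h3 ⊢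
      rw [← not_lt, lexColor_lt_iff]
      rintro (h4 | ⟨h4, h5⟩)
      · omega
      · have := h3 (h2 h4.symm)
        omega
  · simp only [Function.comp_apply, Equiv.Perm.mul_apply, lexColor_eq_iff] at he
    exact hst _ _ (htt i j hij he.1) he.2

/-- The span of the sorting operators for colourings with at least `k` colours. -/
def sortSpan (n p k : ℕ) : Submodule (ZMod p) (Module.End (ZMod p) (GroupAlg n p)) :=
  Submodule.span (ZMod p)
    {u | ∃ f : Fin n → ℕ, k ≤ (Finset.univ.image f).card ∧ u = sortOp p f}

lemma card_image_le_lexColor {n : ℕ} (h f : Fin n → ℕ) :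
    (Finset.univ.image h).card ≤ (Finset.univ.image (lexColor h f)).card := by
  refine Finset.card_le_card_of_surjOn (fun c => c / (∑ l', f l' + 1)) ?_
  intro c hc
  obtain ⟨x, -, rfl⟩ := Finset.mem_image.1 hc
  refine ⟨lexColor h f x, by simp, ?_⟩
  have : f x < ∑ l', f l' + 1 :=
    Nat.lt_succ_of_le (Finset.single_le_sum (fun _ _ => Nat.zero_le _) (Finset.mem_univ x))
  simp only [lexColor]
  rw [Nat.add_comm, Nat.add_mul_div_right _ _ (Nat.succ_pos _), Nat.div_eq_of_lt this, zero_add]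

lemma card_image_lt_lexColor {n : ℕ} (h f : Fin n → ℕ) (x y : Fin n) (hxy : h x = h y)
    (hf : f x ≠ f y) :
    (Finset.univ.image h).card < (Finset.univ.image (lexColor h f)).card := by
  refine lt_of_le_of_ne (card_image_le_lexColor h f) fun heq => hf ?_
  have hdiv : ∀ z, lexColor h f z / (∑ l', f l' + 1) = h z := by
    intro z
    have : f z < ∑ l', f l' + 1 :=
      Nat.lt_succ_of_le (Finset.single_le_sum (fun _ _ => Nat.zero_le _) (Finset.mem_univ z))
    simp only [lexColor]
    rw [Nat.add_comm, Nat.add_mul_div_right _ _ (Nat.succ_pos _), Nat.div_eq_of_lt this, zero_add]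
  have himg : Finset.univ.image h =
      (Finset.univ.image (lexColor h f)).image (fun c => c / (∑ l', f l' + 1)) := by
    rw [Finset.image_image]
    exact Finset.image_congr fun z _ => (hdiv z).symm
  rw [himg] at heq
  have hinj := Finset.card_image_iff.1 heq
  have := hinj (by simp : lexColor h f x ∈ _) (by simp : lexColor h f y ∈ _)
    (by simp only [hdiv, hxy])
  exact ((lexColor_eq_iff h f x y).1 this).2

lemma sortSpan_mul {n p k : ℕ} {u v : Module.End (ZMod p) (GroupAlg n p)}
    (hu : u ∈ sortSpan n p k) (hv : v ∈ sortSpan n p 0) : u * v ∈ sortSpan n p k := by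
  have := Submodule.mul_mem_mul hu hv
  rw [sortSpan, sortSpan, Submodule.span_mul_span] at this
  refine Submodule.span_mono ?_ this
  rintro _ ⟨_, ⟨h, hk, rfl⟩, _, ⟨f, -, rfl⟩, rfl⟩
  exact ⟨_, hk.trans (card_image_le_lexColor h f), sortOp_mul h f⟩

lemma sortSpan_eq_bot {n p k : ℕ} (hk : n < k) : sortSpan n p k = ⊥ := by
  rw [sortSpan, Submodule.span_eq_bot]
  rintro _ ⟨f, hf, -⟩
  have := Finset.card_image_le (s := Finset.univ) (f := f)
  rw [Finset.card_univ, Fintype.card_fin] at this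
  omega

lemma one_mem_sortSpan (n p : ℕ) : 1 ∈ sortSpan n p 0 := by
  refine Submodule.subset_span ⟨fun _ => 0, Nat.zero_le _, end_ext fun w => ?_⟩
  have : Tuple.sort ((fun _ => 0 : Fin n → ℕ) ∘ w) = 1 :=
    Tuple.sort_eq_refl_iff_monotone.2 fun _ _ _ => le_rfl
  rw [sortOp_single, this, mul_one, Module.End.one_apply]

lemma mulRight_Bel (n p : ℕ) (q : Composition n) :
    LinearMap.mulRight (ZMod p) (Bel n p q) =
      ∑ g ∈ Finset.univ.image fun τ : Equiv.Perm (Fin n) =>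
        (blockColor (properPartialSums q) ∘ ⇑τ⁻¹ : Fin n → ℕ), sortOp p g := by
  refine end_ext fun w => ?_
  rw [LinearMap.sum_apply, LinearMap.mulRight_apply, Bel, Finset.mul_sum]
  simp only [sortOp_single, MonoidAlgebra.of_apply, MonoidAlgebra.single_mul_single, mul_one]
  have hcomp : ∀ τ : Equiv.Perm (Fin n),
      (blockColor (properPartialSums q) ∘ ⇑τ⁻¹ : Fin n → ℕ) ∘ w =
        blockColor (properPartialSums q) ∘ ⇑(w⁻¹ * τ)⁻¹ := by
    intro τ; ext; simp
  have hcomp' : ∀ σ : Equiv.Perm (Fin n),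
      (blockColor (properPartialSums q) ∘ ⇑(w * σ)⁻¹ : Fin n → ℕ) ∘ w =
        blockColor (properPartialSums q) ∘ ⇑σ⁻¹ := by
    intro σ; ext; simp
  refine Finset.sum_bij' (fun σ _ => blockColor (properPartialSums q) ∘ ⇑(w * σ)⁻¹)
    (fun g _ => Tuple.sort (g ∘ w)) ?_ ?_ ?_ ?_ ?_
  · exact fun σ _ => Finset.mem_image_of_mem _ (Finset.mem_univ _)
  · intro g hg
    obtain ⟨τ, -, rfl⟩ := Finset.mem_image.1 hg
    rw [hcomp]
    exact Finset.mem_filter.2 ⟨Finset.mem_univ _, descSet_sort_blockColor _ _⟩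
  · intro σ hσ
    rw [hcomp', sort_blockColor σ (Finset.mem_filter.1 hσ).2]
  · intro g hg
    obtain ⟨τ, -, rfl⟩ := Finset.mem_image.1 hg
    ext l
    have h := congrFun (comp_sort_blockColor (properPartialSums q) (w⁻¹ * τ))
    rw [← hcomp] at h
    refine (h _).symm.trans (congrArg (blockColor (properPartialSums q) ∘ ⇑τ⁻¹) ?_)
    exact Equiv.apply_symm_apply (w * _) l
  · intro σ hσ
    rw [hcomp', sort_blockColor σ (Finset.mem_filter.1 hσ).2]

lemma mulRight_mem_sortSpan (n p : ℕ) {a : GroupAlg n p} (ha : a ∈ descentAlgebra n p) :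
    LinearMap.mulRight (ZMod p) a ∈ sortSpan n p 0 := by
  induction ha using Algebra.adjoin_induction with
  | mem a ha =>
    obtain ⟨q, rfl⟩ := ha
    rw [mulRight_Bel]
    exact Submodule.sum_mem _ fun g _ => Submodule.subset_span ⟨g, Nat.zero_le _, rfl⟩
  | algebraMap r =>
    have : LinearMap.mulRight (ZMod p) (algebraMap (ZMod p) (GroupAlg n p) r) = r • 1 := by
      refine LinearMap.ext fun y => ?_
      simp [Algebra.algebraMap_eq_smul_one]
    rw [this]
    exact Submodule.smul_mem _ _ (one_mem_sortSpan n p)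
  | add a b _ _ ha hb =>
    have : LinearMap.mulRight (ZMod p) (a + b) =
        LinearMap.mulRight (ZMod p) a + LinearMap.mulRight (ZMod p) b := by
      refine LinearMap.ext fun y => ?_
      simp [mul_add]
    rw [this]
    exact Submodule.add_mem _ ha hb
  | mul a b _ _ ha hb =>
    rw [LinearMap.mulRight_mul, ← Module.End.mul_eq_comp]
    exact sortSpan_mul hb ha

lemma mulRight_sum_sort {n p : ℕ} (f : Fin n → Fin n → ℕ)
    (hf : ∀ (w : Equiv.Perm (Fin n)) i, f (w i) ∘ w = f i) :
    LinearMap.mulRight (ZMod p)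
      (∑ i, MonoidAlgebra.of (ZMod p) (Equiv.Perm (Fin n)) (Tuple.sort (f i))) =
      ∑ i, sortOp p (f i) := by
  refine end_ext fun w => ?_
  rw [LinearMap.sum_apply, LinearMap.mulRight_apply, Finset.mul_sum]
  simp only [sortOp_single, MonoidAlgebra.of_apply, MonoidAlgebra.single_mul_single, mul_one]
  rw [← Equiv.sum_comp w
    fun i => (MonoidAlgebra.single (w * Tuple.sort (f i ∘ w)) 1 : GroupAlg n p)]
  simp only [hf]

lemma mulRight_front_sub_back (m p : ℕ) :
    LinearMap.mulRight (ZMod p) (increasingSum (m + 1) p 1 (m + 1) - increasingSum (m + 1) p 0 m) =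
      ∑ i, (sortOp p (frontColor i) - sortOp p (backColor i)) := by
  have h : ∀ a b : GroupAlg (m + 1) p, LinearMap.mulRight (ZMod p) (a - b) =
      LinearMap.mulRight (ZMod p) a - LinearMap.mulRight (ZMod p) b := fun a b => by
    refine LinearMap.ext fun y => ?_
    simp [mul_sub]
  rw [h, increasingSum_front, increasingSum_back, mulRight_sum_sort, mulRight_sum_sort,
    Finset.sum_sub_distrib]
  · intro w i
    ext l
    simp [backColor]
  · intro w i
    ext l
    simp [frontColor]

lemma sortSpan_mul_front_sub_back {m p k : ℕ} {u : Module.End (ZMod p) (GroupAlg (m + 1) p)}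
    (hu : u ∈ sortSpan (m + 1) p k) :
    u * LinearMap.mulRight (ZMod p)
      (increasingSum (m + 1) p 1 (m + 1) - increasingSum (m + 1) p 0 m) ∈
      sortSpan (m + 1) p (k + 1) := by
  rw [mulRight_front_sub_back, Finset.mul_sum]
  refine Submodule.sum_mem _ fun i _ => ?_
  induction hu using Submodule.span_induction with
  | zero => rw [zero_mul]; exact Submodule.zero_mem _
  | add u v _ _ hu hv => rw [add_mul]; exact Submodule.add_mem _ hu hv
  | smul r u _ hu => rw [smul_mul_assoc]; exact Submodule.smul_mem _ _ hu
  | mem u hu =>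
    obtain ⟨h, hk, rfl⟩ := hu
    rw [mul_sub, sortOp_mul, sortOp_mul]
    by_cases hi : ∃ j, j ≠ i ∧ h j = h i
    · obtain ⟨j, hji, hj⟩ := hi
      refine Submodule.sub_mem _ (Submodule.subset_span ⟨_, ?_, rfl⟩)
        (Submodule.subset_span ⟨_, ?_, rfl⟩)
      · exact hk.trans_lt (card_image_lt_lexColor h _ j i hj (by simp [frontColor, hji]))
      · exact hk.trans_lt (card_image_lt_lexColor h _ j i hj (by simp [backColor, hji]))
    · push Not at hi
      rw [sortOp_congr (f := lexColor h (frontColor i)) (g := lexColor h (backColor i)), sub_self]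
      · exact Submodule.zero_mem _
      · intro x y
        rw [lexColor_lt_iff, lexColor_lt_iff]
        refine or_congr_right (and_congr_right fun hxy => ?_)
        have hx := hi x
        have hy := hi y
        simp only [frontColor, backColor]
        by_cases h1 : x = i <;> by_cases h2 : y = i <;> simp_all

lemma isNilpotent_mul_front_sub_back (m p : ℕ) {a : GroupAlg (m + 1) p}
    (ha : a ∈ descentAlgebra (m + 1) p) :
    IsNilpotent (a * (increasingSum (m + 1) p 1 (m + 1) - increasingSum (m + 1) p 0 m)) := by
  set x := increasingSum (m + 1) p 1 (m + 1) - increasingSum (m + 1) p 0 m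
  have key : ∀ k, LinearMap.mulRight (ZMod p) ((x * a) ^ k) ∈ sortSpan (m + 1) p k := by
    intro k
    induction k with
    | zero =>
      rw [pow_zero, LinearMap.mulRight_one]
      exact one_mem_sortSpan (m + 1) p
    | succ k ih =>
      have h : LinearMap.mulRight (ZMod p) ((x * a) ^ (k + 1)) =
          LinearMap.mulRight (ZMod p) ((x * a) ^ k) * LinearMap.mulRight (ZMod p) a *
            LinearMap.mulRight (ZMod p) x := by
        refine LinearMap.ext fun y => ?_
        simp [pow_succ', mul_assoc]
      rw [h]
      exact sortSpan_mul_front_sub_back (sortSpan_mul ih (mulRight_mem_sortSpan _ p ha))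
  have hzero := key (m + 2)
  rw [sortSpan_eq_bot (by omega), Submodule.mem_bot] at hzero
  have hxa : (x * a) ^ (m + 2) = 0 := by
    simpa using LinearMap.congr_fun hzero 1
  refine ⟨m + 3, ?_⟩
  rw [pow_succ, ← mul_assoc, mul_pow_mul, hxa, mul_zero, zero_mul]

/-- For `n ≥ 3`, `x = B̄_{[1,n-1]} - B̄_{[n-1,1]}` lies in `R(n,p)` and
satisfies `x^{n-2} ≠ 0`; indeed `x^r = Σ_{k=0}^{r} (-1)^k C(r,k) B̄_{[1^{r-k}, n-r, 1^k]}`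
for `0 ≤ r ≤ n-2`. -/
theorem stmt17 (n p : ℕ) (hn : 3 ≤ n) (hp : p.Prime) :
    ∀ x : GroupAlg n p,
      x = Bel n p (compD n 1 0 (by omega)) - Bel n p (compD n 0 1 (by omega)) →
      x ∈ descentRadicalSubmodule n p ∧ x ^ (n - 2) ≠ 0 ∧
      ∀ (r : ℕ) (hr : r ≤ n - 2),
        x ^ r = ∑ k : Fin (r + 1),
          ((-1 : ZMod p) ^ (k : ℕ) * (r.choose (k : ℕ) : ZMod p)) •
            Bel n p (compD n (r - (k : ℕ)) (k : ℕ)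
              (by have := k.isLt; omega)) := by
  intro x hx
  obtain ⟨m, rfl⟩ : ∃ m, n = m + 1 := ⟨n - 1, by omega⟩
  have hx' : x = increasingSum (m + 1) p 1 (m + 1) - increasingSum (m + 1) p 0 m := by
    rw [hx, Bel_compD, Bel_compD]
    rfl
  refine ⟨?_, ?_, fun r hr => ?_⟩
  · have hxmem : x ∈ descentAlgebra (m + 1) p := by
      rw [hx]
      exact Subalgebra.sub_mem _ (BelS _ p _).2 (BelS _ p _).2
    refine Submodule.mem_map.2 ⟨⟨x, hxmem⟩, ?_, rfl⟩
    refine Ideal.mem_jacobson_iff.2 fun y => ?_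
    have hnil : IsNilpotent (y * ⟨x, hxmem⟩ : descentAlgebra (m + 1) p) := by
      obtain ⟨k, hk⟩ := isNilpotent_mul_front_sub_back m p y.2
      refine ⟨k, Subtype.ext ?_⟩
      rw [← hx'] at hk
      simpa using hk
    obtain ⟨z, hz⟩ := hnil.isUnit_one_add.exists_left_inv
    refine ⟨z, ?_⟩
    rw [Ideal.mem_bot, sub_eq_zero, ← hz, mul_add, mul_one, mul_assoc]
    exact add_comm _ _
  · rw [hx', show m + 1 - 2 = m - 1 by omega]
    exact front_sub_back_pow_ne_zero m p (by omega) hp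
  · rw [hx', front_sub_back_pow m p r (by omega), Finset.Nat.sum_antidiagonal_eq_sum_range_succ
      (fun i j => r.choose i • ((-1 : ZMod p) ^ i • increasingSum (m + 1) p j (m + 1 - i))),
      Finset.sum_range]
    refine Finset.sum_congr rfl fun k _ => ?_
    rw [Bel_compD, mul_comm, mul_smul, Nat.cast_smul_eq_nsmul]

end
end

section
/- The subspace T of Σ(n,p) spanned by all differences B̄_q − B̄_r with q ≈ r is a two-sided ideal of Σ(n,p), is nilpotent, and is contained in the Jacobson radical R(n,p). -/
open scoped Classical

set_option synthInstance.maxHeartbeats 1000000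
set_option maxHeartbeats 1000000

noncomputable section

/-- Two functions on finite types with equinumerous fibres differ by a bijection. -/
theorem exists_equiv_comp_eq_of_card_fiber {α β γ : Type*} [Fintype α] [Fintype β]
    (f : α → γ) (g : β → γ)
    (h : ∀ c, (Finset.univ.filter fun a => f a = c).card =
      (Finset.univ.filter fun b => g b = c).card) :
    ∃ e : α ≃ β, ∀ a, g (e a) = f a := by
  have h' : ∀ c, Nonempty ({a // f a = c} ≃ {b // g b = c}) := fun c => by
    rw [← Fintype.card_eq, Fintype.card_subtype, Fintype.card_subtype]
    exact h c
  exact ⟨Equiv.ofFiberEquiv fun c => (h' c).some, fun a => Equiv.ofFiberEquiv_map _ a⟩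

/-- The number of elements of each fibre of `f`. -/
def fiberCard {n : ℕ} {ι : Type} (f : Fin n → ι) (i : ι) : ℕ :=
  (Finset.univ.filter fun x => f x = i).card

theorem fiberCard_comp_perm {n : ℕ} {ι : Type} (f : Fin n → ι) (σ : Equiv.Perm (Fin n)) :
    fiberCard (f ∘ σ) = fiberCard f := by
  funext i
  refine Finset.card_bij (fun x _ => σ x) ?_ ?_ ?_
  · intro x hx; simpa using hx
  · intro x _ y _ h; simpa using h
  · intro y hy; exact ⟨σ.symm y, by simpa using hy, by simp⟩

theorem sum_fiberCard {n : ℕ} {ι : Type} [Fintype ι] (f : Fin n → ι) :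
    ∑ i, fiberCard f i = n := by
  have h := Finset.card_eq_sum_card_fiberwise (f := f) (s := Finset.univ) (t := Finset.univ)
    (by simp)
  simpa [fiberCard] using h.symm

theorem fiberCard_le {n : ℕ} {ι : Type} (f : Fin n → ι) (i : ι) : fiberCard f i ≤ n :=
  (Finset.card_le_univ _).trans (by simp)

theorem fiberCard_injective_comp {n : ℕ} {ι κ : Type} (φ : ι → κ) (hφ : Function.Injective φ)
    (f : Fin n → ι) (i : ι) : fiberCard (φ ∘ f) (φ i) = fiberCard f i := by
  simp [fiberCard, hφ.eq_iff]

/-- The sum of the stable sorting permutations of all functions with fibre sizes `z`. -/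
def sortSum (n p : ℕ) {ι : Type} [LinearOrder ι] [Fintype ι] (z : ι → ℕ) : GroupAlg n p :=
  ∑ f ∈ Finset.univ.filter (fun f : Fin n → ι => fiberCard f = z),
    MonoidAlgebra.of (ZMod p) (Equiv.Perm (Fin n)) (Tuple.sort f)

theorem fiberCard_index {n : ℕ} (q : Composition n) : fiberCard q.index = q.blocksFun := by
  funext i
  have h : (Finset.univ.filter fun x => q.index x = i) =
      Finset.univ.map (q.embedding i).toEmbedding := by
    ext x
    have := q.mem_range_embedding_iff' (j := x) (i := i)
    simp only [Finset.mem_filter, Finset.mem_univ, true_and, Finset.mem_map]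
    rw [eq_comm, ← this]
    rfl
  have h' := congrArg Finset.card h
  rw [Finset.card_map, Finset.card_fin] at h'
  rw [← h']
  unfold fiberCard
  congr

theorem index_monotone {n : ℕ} (q : Composition n) : Monotone q.index := by
  intro x y hxy
  by_contra! h
  have h1 := q.sizeUpTo_index_le x
  have h2 := q.lt_sizeUpTo_index_succ y
  have h3 : q.sizeUpTo (q.index y).succ ≤ q.sizeUpTo (q.index x) :=
    q.monotone_sizeUpTo (Nat.succ_le_of_lt h)
  have h4 : (x : ℕ) ≤ y := hxy
  simp only [Fin.val_succ] at *
  omega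

theorem mem_properPartialSums_iff {n : ℕ} (q : Composition n) (k : ℕ) (hk : k < n) (hk0 : 0 < k) :
    k ∈ properPartialSums q ↔ q.index ⟨k - 1, by omega⟩ ≠ q.index ⟨k, hk⟩ := by
  constructor
  · rintro ⟨m, -, -, rfl⟩ h
    have h1 := q.sizeUpTo_index_le ⟨q.sizeUpTo m - 1, by omega⟩
    have h2 := q.lt_sizeUpTo_index_succ ⟨_, hk⟩
    rw [h] at h1
    simp only [Fin.val_succ] at h1 h2
    have h3 : ¬ m ≤ (q.index ⟨_, hk⟩ : ℕ) := fun h3 => by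
      have := q.monotone_sizeUpTo h3
      omega
    have h4 : ¬ (q.index ⟨_, hk⟩ : ℕ) + 1 ≤ m := fun h4 => by
      have := q.monotone_sizeUpTo h4
      omega
    omega
  · intro h
    have hlt : q.index ⟨k - 1, by omega⟩ < q.index ⟨k, hk⟩ :=
      lt_of_le_of_ne (index_monotone q (by simp)) h
    refine ⟨q.index ⟨k, hk⟩, lt_of_le_of_lt (Nat.zero_le _) (Fin.lt_def.mp hlt), (q.index _).2, ?_⟩
    have h1 := q.sizeUpTo_index_le ⟨k, hk⟩
    have h2 := q.lt_sizeUpTo_index_succ ⟨k - 1, by omega⟩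
    have h3 := q.monotone_sizeUpTo (Nat.succ_le_of_lt (Fin.lt_def.mp hlt))
    simp only [Nat.succ_eq_add_one, Fin.val_succ] at h1 h2 h3
    omega

theorem descSet_subset_iff_s19 {n : ℕ} (q : Composition n) (σ : Equiv.Perm (Fin n)) :
    descSet σ ⊆ properPartialSums q ↔
      ∀ i j, i < j → q.index i = q.index j → σ i < σ j := by
  constructor
  · intro h
    have step : ∀ d : ℕ, ∀ i j : Fin n, (j : ℕ) = i + d + 1 → q.index i = q.index j →
        σ i < σ j := by
      intro d
      induction d with
      | zero =>
        intro i j hij hq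
        by_contra! hlt
        have hne : σ j ≠ σ i := fun h => by
          have := σ.injective h
          subst this
          omega
        have hi : (⟨(j : ℕ) - 1, by omega⟩ : Fin n) = i := Fin.ext (by simp; omega)
        have hm : (j : ℕ) ∈ descSet σ := ⟨j.2, by omega, by
          rw [hi]; exact lt_of_le_of_ne hlt hne⟩
        have := (mem_properPartialSums_iff q j j.2 (by omega)).1 (h hm)
        rw [hi] at this
        exact this hq
      | succ d ih =>
        intro i j hij hq
        have hm : q.index i = q.index ⟨(j : ℕ) - 1, by omega⟩ := by
          refine le_antisymm (index_monotone q ?_) (hq ▸ index_monotone q ?_)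
          · rw [Fin.le_def]; simp; omega
          · rw [Fin.le_def]; simp
        have h1 := ih i ⟨(j : ℕ) - 1, by omega⟩ (by simp; omega) hm
        refine h1.trans ?_
        by_contra! hlt
        have hne : σ j ≠ σ ⟨(j : ℕ) - 1, by omega⟩ := fun h => by
          have := Fin.ext_iff.1 (σ.injective h)
          simp at this
          omega
        have hm' : (j : ℕ) ∈ descSet σ := ⟨j.2, by omega, lt_of_le_of_ne hlt hne⟩
        exact (mem_properPartialSums_iff q j j.2 (by omega)).1 (h hm') (hm.symm.trans hq)
    intro i j hij
    exact step (j - i - 1) i j (by have : (i : ℕ) < j := hij; omega)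
  · rintro h k ⟨hk, hk0, hlt⟩
    rw [mem_properPartialSums_iff q k hk hk0]
    intro heq
    exact lt_asymm hlt (h _ _ (by rw [Fin.lt_def]; simp; omega) heq)

theorem comp_sort_eq_index {n : ℕ} (q : Composition n) (f : Fin n → Fin q.length)
    (hf : fiberCard f = q.blocksFun) : f ∘ Tuple.sort f = q.index := by
  obtain ⟨e, he⟩ := exists_equiv_comp_eq_of_card_fiber q.index f fun c => by
    have := congrFun (hf.trans (fiberCard_index q).symm) c
    unfold fiberCard at this
    convert this.symm
  have he' : f ∘ e = q.index := funext he
  rw [← he']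
  exact Tuple.unique_monotone (Tuple.monotone_sort f) (he' ▸ index_monotone q)

theorem Bel_eq_sortSum (n p : ℕ) (q : Composition n) :
    Bel n p q = sortSum n p q.blocksFun := by
  have key : ∀ σ : Equiv.Perm (Fin n), descSet σ ⊆ properPartialSums q →
      Tuple.sort (q.index ∘ σ.symm) = σ := by
    intro σ hσ
    rw [descSet_subset_iff_s19] at hσ
    refine (Tuple.eq_sort_iff.2 ⟨?_, ?_⟩).symm
    · rw [Function.comp_assoc]; simpa using index_monotone q
    · intro i j hij h
      exact hσ i j hij (by simpa using h)
  unfold Bel sortSum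
  refine Finset.sum_bij' (fun σ _ => q.index ∘ σ.symm) (fun f _ => Tuple.sort f) ?_ ?_ ?_ ?_ ?_
  · intro σ _
    simp [fiberCard_comp_perm, fiberCard_index]
  · intro f hf
    simp only [Finset.mem_filter, Finset.mem_univ, true_and] at hf ⊢
    rw [descSet_subset_iff_s19]
    intro i j hij h
    rw [← comp_sort_eq_index q f hf] at h
    exact (Tuple.eq_sort_iff.1 rfl).2 i j hij h
  · intro σ hσ
    exact key σ (by simpa using hσ)
  · intro f hf
    rw [← comp_sort_eq_index q f (by simpa using hf)]
    funext x
    simp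
  · intro σ hσ
    rw [key σ (by simpa using hσ)]

theorem sortSum_eq_zero {n p : ℕ} {ι : Type} [LinearOrder ι] [Fintype ι] {z : ι → ℕ}
    (hz : ∑ i, z i ≠ n) : sortSum n p z = 0 := by
  refine Finset.sum_eq_zero fun f hf => absurd ?_ hz
  simp only [Finset.mem_filter, Finset.mem_univ, true_and] at hf
  rw [← hf, sum_fiberCard]

theorem sort_comp_strictMono {n : ℕ} {ι κ : Type} [LinearOrder ι] [LinearOrder κ] (φ : ι → κ)
    (hφ : StrictMono φ) (f : Fin n → ι) : Tuple.sort (φ ∘ f) = Tuple.sort f := by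
  refine (Tuple.eq_sort_iff.2 ⟨?_, ?_⟩).symm
  · exact hφ.monotone.comp (Tuple.monotone_sort f)
  · intro i j hij h
    exact (Tuple.eq_sort_iff.1 rfl).2 i j hij (hφ.injective h)

theorem sortSum_eq_comp_strictMono {n p : ℕ} {ι κ : Type} [LinearOrder ι] [Fintype ι]
    [LinearOrder κ] [Fintype κ] (z : κ → ℕ) (φ : ι → κ) (hφ : StrictMono φ)
    (hz : ∀ k, z k ≠ 0 → ∃ i, φ i = k) : sortSum n p z = sortSum n p (z ∘ φ) := by
  symm
  unfold sortSum
  refine Finset.sum_bij (fun f _ => φ ∘ f) ?_ ?_ ?_ ?_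
  · intro f hf
    simp only [Finset.mem_filter, Finset.mem_univ, true_and] at hf ⊢
    funext k
    by_cases hk : ∃ i, φ i = k
    · obtain ⟨i, rfl⟩ := hk
      rw [fiberCard_injective_comp φ hφ.injective, hf]; rfl
    · have h0 : z k = 0 := by
        by_contra h; exact hk (hz k h)
      rw [h0]
      simp only [fiberCard, Finset.card_eq_zero, Finset.filter_eq_empty_iff, Finset.mem_univ,
        true_implies]
      exact fun x hx => hk ⟨_, hx⟩
  · intro f _ g _ h
    exact hφ.injective.comp_left h
  · intro F hF
    simp only [Finset.mem_filter, Finset.mem_univ, true_and] at hF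
    have : ∀ x, ∃ i, φ i = F x := fun x => hz _ (by
      rw [← hF]
      exact (Finset.card_pos.2 ⟨x, by simp⟩).ne')
    choose f hf using this
    have hF' : φ ∘ f = F := funext hf
    refine ⟨f, ?_, hF'⟩
    simp only [Finset.mem_filter, Finset.mem_univ, true_and]
    funext i
    rw [← fiberCard_injective_comp φ hφ.injective, hF', hF]; rfl
  · intro f _
    rw [sort_comp_strictMono φ hφ]

theorem exists_composition {n p : ℕ} {ι : Type} [LinearOrder ι] [Fintype ι] (z : ι → ℕ)
    (hz : ∑ i, z i = n) :
    ∃ q : Composition n, sortSum n p z = Bel n p q ∧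
      (q.blocks : Multiset ℕ) = (Finset.univ.val.map z).filter (· ≠ 0) := by
  set S : Finset ι := Finset.univ.filter (fun i => z i ≠ 0) with hS
  let φ := S.orderEmbOfFin rfl
  have hφS : ∀ i, φ i ∈ S := fun i => S.orderEmbOfFin_mem rfl i
  have hmap : Finset.univ.map φ.toEmbedding = S := S.map_orderEmbOfFin_univ rfl
  have hsum : ∑ i, z (φ i) = n := by
    have : ∑ i ∈ S, z i = n := by rw [hS, Finset.sum_filter_ne_zero, hz]
    rw [← hmap, Finset.sum_map] at this
    exact this
  let q : Composition n :=
    { blocks := List.ofFn (z ∘ φ)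
      blocks_pos := by
        intro i hi
        obtain ⟨a, rfl⟩ := (List.mem_ofFn' _ _).1 hi
        have := hφS a
        simp only [hS, Finset.mem_filter] at this
        exact Nat.pos_of_ne_zero this.2
      blocks_sum := by rw [List.sum_ofFn]; exact hsum }
  have hlen : q.length = S.card := by simp [q, Composition.length]
  refine ⟨q, ?_, ?_⟩
  · rw [Bel_eq_sortSum, sortSum_eq_comp_strictMono z (φ ∘ Fin.cast hlen)]
    · congr 1
      funext i
      simp [q, Composition.blocksFun, Composition.length]
      rfl
    · exact φ.strictMono.comp (Fin.cast_strictMono hlen)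
    · intro k hk
      have : k ∈ Finset.univ.map φ.toEmbedding := by rw [hmap]; simp [hS, hk]
      obtain ⟨i, -, hi⟩ := Finset.mem_map.1 this
      exact ⟨Fin.cast hlen.symm i, by simpa using hi⟩
  · have h1 : (q.blocks : Multiset ℕ) = Finset.univ.val.map (z ∘ φ) := by
      simp only [q]
      rw [Fin.univ_val_map]
    rw [h1, Multiset.filter_map, ← Multiset.map_map]
    congr 1
    have := congrArg Finset.val hmap
    rw [Finset.map_val] at this
    exact this

theorem sortSum_sub_comp_equiv_mem_Tsub {n p : ℕ} {ι κ : Type} [LinearOrder ι] [Fintype ι]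
    [LinearOrder κ] [Fintype κ] (z : ι → ℕ) (e : κ ≃ ι) :
    sortSum n p z - sortSum n p (z ∘ e) ∈ Tsub n p := by
  have hs : ∑ k, (z ∘ e) k = ∑ i, z i := e.sum_comp z
  by_cases hz : ∑ i, z i = n
  · obtain ⟨q, hq, hqb⟩ := exists_composition (p := p) z hz
    obtain ⟨r, hr, hrb⟩ := exists_composition (p := p) (z ∘ e) (hs.trans hz)
    refine Submodule.subset_span ⟨q, r, ?_, by rw [hq, hr]⟩
    rw [← Multiset.coe_eq_coe, hqb, hrb, ← Multiset.map_map]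
    congr 2
    have := congrArg Finset.val (Finset.map_univ_equiv e)
    rw [Finset.map_val] at this
    exact this.symm
  · rw [sortSum_eq_zero hz, sortSum_eq_zero (hs.trans_ne hz), sub_zero]
    exact zero_mem _

theorem sortSum_mem_Ysub {n p m : ℕ} {ι : Type} [LinearOrder ι] [Fintype ι] (z : ι → ℕ)
    (hm : m ≤ (Finset.univ.filter fun i => z i ≠ 0).card) : sortSum n p z ∈ Ysub n p m := by
  by_cases hz : ∑ i, z i = n
  · obtain ⟨q, hq, hqb⟩ := exists_composition (p := p) z hz
    refine Submodule.subset_span ⟨q, ?_, hq⟩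
    have := congrArg Multiset.card hqb
    rw [Multiset.filter_map, Multiset.card_map, Multiset.coe_card] at this
    rw [Composition.length, this]
    convert hm using 1
    rw [Finset.card, Finset.filter_val]
    congr
  · rw [sortSum_eq_zero hz]
    exact zero_mem _

theorem sort_mul_sort {n : ℕ} {ι κ : Type} [LinearOrder ι] [LinearOrder κ]
    (f : Fin n → ι) (h : Fin n → κ) :
    Tuple.sort f * Tuple.sort (h ∘ Tuple.sort f) = Tuple.sort (fun x => toLex (h x, f x)) := by
  set σ := Tuple.sort f with hσ
  set τ := Tuple.sort (h ∘ σ) with hτ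
  have hσ' := Tuple.eq_sort_iff.1 hσ
  have hτ' := Tuple.eq_sort_iff.1 hτ
  have hmono : ∀ i j, i < j → h (σ (τ i)) = h (σ (τ j)) → τ i < τ j := hτ'.2
  refine Tuple.eq_sort_iff.2 ⟨monotone_iff_forall_lt.2 fun i j hij => ?_, ?_⟩
  · simp only [Function.comp_apply, Equiv.Perm.mul_apply, Prod.Lex.toLex_le_toLex]
    rcases (hτ'.1 hij.le).lt_or_eq with hlt | heq
    · exact Or.inl hlt
    · exact Or.inr ⟨heq, hσ'.1 (hmono i j hij heq).le⟩
  · intro i j hij heq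
    simp only [Equiv.Perm.mul_apply, toLex_inj, Prod.mk.injEq] at heq ⊢
    exact hσ'.2 _ _ (hmono i j hij heq.1) heq.2

/-- The matrices with row sums `y` and column sums `z`, entries at most `n`. -/
def marginMatrices (n : ℕ) {ι κ : Type} [Fintype ι] [Fintype κ] (y : κ → ℕ) (z : ι → ℕ) :
    Finset (κ ×ₗ ι → ℕ) :=
  (Fintype.piFinset fun _ => Finset.range (n + 1)).filter fun Z =>
    (∀ k, ∑ i, Z (toLex (k, i)) = y k) ∧ ∀ i, ∑ k, Z (toLex (k, i)) = z i

theorem sum_fiberCard_fst {n : ℕ} {ι κ : Type} [Fintype ι] (F : Fin n → κ ×ₗ ι) (k : κ) :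
    ∑ i, fiberCard F (toLex (k, i)) = fiberCard (fun x => (ofLex (F x)).1) k := by
  unfold fiberCard
  rw [Finset.card_eq_sum_card_fiberwise (f := fun x => (ofLex (F x)).2) (t := Finset.univ)
    (by simp)]
  refine Finset.sum_congr rfl fun i _ => congrArg Finset.card ?_
  ext x
  simp only [Finset.mem_filter, Finset.mem_univ, true_and]
  rw [← ofLex_inj, ofLex_toLex, Prod.ext_iff]

theorem sum_fiberCard_snd {n : ℕ} {ι κ : Type} [Fintype κ] (F : Fin n → κ ×ₗ ι) (i : ι) :
    ∑ k, fiberCard F (toLex (k, i)) = fiberCard (fun x => (ofLex (F x)).2) i := by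
  unfold fiberCard
  rw [Finset.card_eq_sum_card_fiberwise (f := fun x => (ofLex (F x)).1) (t := Finset.univ)
    (by simp)]
  refine Finset.sum_congr rfl fun k _ => congrArg Finset.card ?_
  ext x
  simp only [Finset.mem_filter, Finset.mem_univ, true_and]
  rw [← ofLex_inj, ofLex_toLex, Prod.ext_iff, and_comm]

/-- Solomon's multiplication rule for sums of sorting permutations. -/
theorem sortSum_mul_sortSum {n p : ℕ} {ι κ : Type} [LinearOrder ι] [Fintype ι]
    [LinearOrder κ] [Fintype κ] (z : ι → ℕ) (y : κ → ℕ) :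
    sortSum n p z * sortSum n p y = ∑ Z ∈ marginMatrices n y z, sortSum n p Z := by
  have inner : ∀ f : Fin n → ι,
      MonoidAlgebra.of (ZMod p) (Equiv.Perm (Fin n)) (Tuple.sort f) * sortSum n p y =
      ∑ h ∈ Finset.univ.filter (fun h : Fin n → κ => fiberCard h = y),
        MonoidAlgebra.of (ZMod p) (Equiv.Perm (Fin n))
          (Tuple.sort fun x => toLex (h x, f x)) := by
    intro f
    rw [sortSum, Finset.mul_sum]
    refine Finset.sum_bij' (fun g _ => g ∘ (Tuple.sort f).symm) (fun h _ => h ∘ Tuple.sort f)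
      ?_ ?_ ?_ ?_ ?_
    · intro g hg; simpa [fiberCard_comp_perm] using hg
    · intro h hh; simpa [fiberCard_comp_perm] using hh
    · intro g _; funext x; simp
    · intro h _; funext x; simp
    · intro g _
      rw [← map_mul, ← sort_mul_sort f]
      congr 3
      funext x; simp
  have lhs : sortSum n p z * sortSum n p y =
      ∑ F ∈ Finset.univ.filter (fun F : Fin n → κ ×ₗ ι =>
        fiberCard (fun x => (ofLex (F x)).1) = y ∧ fiberCard (fun x => (ofLex (F x)).2) = z),
        MonoidAlgebra.of (ZMod p) (Equiv.Perm (Fin n)) (Tuple.sort F) := by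
    conv_lhs => rw [sortSum, Finset.sum_mul]
    simp only [inner]
    rw [← Finset.sum_product']
    refine Finset.sum_bij' (fun P _ => fun x => toLex (P.2 x, P.1 x))
      (fun F _ => (fun x => (ofLex (F x)).2, fun x => (ofLex (F x)).1)) ?_ ?_ ?_ ?_ ?_
    · rintro ⟨f, h⟩ hm
      simp only [Finset.mem_product, Finset.mem_filter, Finset.mem_univ, true_and] at hm ⊢
      exact ⟨hm.2, hm.1⟩
    · intro F hF
      simp only [Finset.mem_product, Finset.mem_filter, Finset.mem_univ, true_and] at hF ⊢
      exact ⟨hF.2, hF.1⟩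
    · rintro ⟨f, h⟩ _; rfl
    · intro F _; rfl
    · rintro ⟨f, h⟩ _; rfl
  rw [lhs, ← Finset.sum_fiberwise_of_maps_to (t := marginMatrices n y z) (g := fiberCard)]
  · refine Finset.sum_congr rfl fun Z hZ => ?_
    rw [sortSum]
    refine Finset.sum_congr ?_ fun _ _ => rfl
    ext F
    simp only [marginMatrices, Finset.mem_filter, Finset.mem_univ, true_and] at hZ ⊢
    refine ⟨fun h => h.2, fun h => ⟨⟨?_, ?_⟩, h⟩⟩
    · funext k; rw [← sum_fiberCard_fst, h, hZ.2.1 k]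
    · funext i; rw [← sum_fiberCard_snd, h, hZ.2.2 i]
  · intro F hF
    simp only [marginMatrices, Finset.mem_filter, Finset.mem_univ, true_and,
      Fintype.mem_piFinset, Finset.mem_range] at hF ⊢
    refine ⟨fun a => Nat.lt_succ_of_le (fiberCard_le F a), fun k => ?_, fun i => ?_⟩
    · rw [sum_fiberCard_fst, hF.1]
    · rw [sum_fiberCard_snd, hF.2]

/-- The action of a pair of bijections on the index set of matrices. -/
def lexCongr {ι ι' κ κ' : Type} (e₁ : κ' ≃ κ) (e₂ : ι' ≃ ι) : κ' ×ₗ ι' ≃ κ ×ₗ ι :=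
  ofLex.trans ((Equiv.prodCongr e₁ e₂).trans toLex)

theorem sortSum_comp_mul_sortSum_comp {n p : ℕ} {ι ι' κ κ' : Type} [LinearOrder ι] [Fintype ι]
    [LinearOrder κ] [Fintype κ] [LinearOrder ι'] [Fintype ι'] [LinearOrder κ'] [Fintype κ']
    (z : ι → ℕ) (y : κ → ℕ) (e₁ : κ' ≃ κ) (e₂ : ι' ≃ ι) :
    sortSum n p (z ∘ e₂) * sortSum n p (y ∘ e₁) =
      ∑ Z ∈ marginMatrices n y z, sortSum n p (Z ∘ lexCongr e₁ e₂) := by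
  rw [sortSum_mul_sortSum]
  symm
  refine Finset.sum_bij' (fun Z _ => Z ∘ lexCongr e₁ e₂)
    (fun Z _ => Z ∘ (lexCongr e₁ e₂).symm) ?_ ?_ ?_ ?_ ?_
  · intro Z hZ
    simp only [marginMatrices, Finset.mem_filter, Fintype.mem_piFinset] at hZ ⊢
    refine ⟨fun a => hZ.1 _, fun k => ?_, fun i => ?_⟩
    · exact (e₂.sum_comp fun i => Z (toLex (e₁ k, i))).trans (hZ.2.1 _)
    · exact (e₁.sum_comp fun k => Z (toLex (k, e₂ i))).trans (hZ.2.2 _)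
  · intro Z hZ
    simp only [marginMatrices, Finset.mem_filter, Fintype.mem_piFinset] at hZ ⊢
    refine ⟨fun a => hZ.1 _, fun k => ?_, fun i => ?_⟩
    · refine (e₂.symm.sum_comp fun i => Z (toLex (e₁.symm k, i))).trans ((hZ.2.1 _).trans ?_)
      simp
    · refine (e₁.symm.sum_comp fun k => Z (toLex (k, e₂.symm i))).trans ((hZ.2.2 _).trans ?_)
      simp
  · intro Z _; funext a; simp
  · intro Z _; funext a; simp
  · intro Z _; rfl

theorem sortSum_mul_sub_mem_Tsub {n p : ℕ} {ι ι' κ κ' : Type} [LinearOrder ι] [Fintype ι]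
    [LinearOrder κ] [Fintype κ] [LinearOrder ι'] [Fintype ι'] [LinearOrder κ'] [Fintype κ']
    (z : ι → ℕ) (y : κ → ℕ) (e₁ : κ' ≃ κ) (e₂ : ι' ≃ ι) :
    sortSum n p z * sortSum n p y - sortSum n p (z ∘ e₂) * sortSum n p (y ∘ e₁) ∈ Tsub n p := by
  rw [sortSum_comp_mul_sortSum_comp, sortSum_mul_sortSum, ← Finset.sum_sub_distrib]
  exact Submodule.sum_mem _ fun Z _ => sortSum_sub_comp_equiv_mem_Tsub Z _

theorem exists_blocksFun_comp_eq {n : ℕ} {q r : Composition n} (h : q.blocks.Perm r.blocks) :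
    ∃ e : Fin r.length ≃ Fin q.length, r.blocksFun = q.blocksFun ∘ e := by
  have count : ∀ (s : Composition n) (c : ℕ),
      (Finset.univ.filter fun i => s.blocksFun i = c).card = s.blocks.count c := by
    intro s c
    rw [← s.ofFn_blocksFun, ← Multiset.coe_count, ← Fin.univ_val_map, Multiset.count_map,
      Finset.card, Finset.filter_val]
    simp only [eq_comm]
  obtain ⟨e, he⟩ := exists_equiv_comp_eq_of_card_fiber r.blocksFun q.blocksFun fun c => by
    have := (count r c).trans ((h.count_eq c).symm.trans (count q c).symm)
    convert this
  exact ⟨e, funext fun i => (he i).symm⟩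

theorem mul_mem_Tsub {n p : ℕ} {x t : GroupAlg n p} (hx : x ∈ descentAlgebra n p)
    (ht : t ∈ Tsub n p) : x * t ∈ Tsub n p ∧ t * x ∈ Tsub n p := by
  induction hx using Algebra.adjoin_induction generalizing t with
  | mem x hx =>
    obtain ⟨s, rfl⟩ := hx
    induction ht using Submodule.span_induction with
    | mem t ht =>
      obtain ⟨q, r, hqr, rfl⟩ := ht
      obtain ⟨e, he⟩ := exists_blocksFun_comp_eq hqr
      simp only [Bel_eq_sortSum, he, mul_sub, sub_mul]
      exact ⟨sortSum_mul_sub_mem_Tsub s.blocksFun q.blocksFun e (Equiv.refl _),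
        sortSum_mul_sub_mem_Tsub q.blocksFun s.blocksFun (Equiv.refl _) e⟩
    | zero => simp
    | add t u _ _ ht hu =>
      rw [mul_add, add_mul]
      exact ⟨add_mem ht.1 hu.1, add_mem ht.2 hu.2⟩
    | smul c t _ ht =>
      rw [mul_smul_comm, smul_mul_assoc]
      exact ⟨Submodule.smul_mem _ _ ht.1, Submodule.smul_mem _ _ ht.2⟩
  | algebraMap c =>
    rw [← Algebra.commutes, and_self, ← Algebra.smul_def]
    exact Submodule.smul_mem _ _ ht
  | add x y _ _ hx hy =>
    rw [mul_add, add_mul]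
    exact ⟨add_mem (hx ht).1 (hy ht).1, add_mem (hx ht).2 (hy ht).2⟩
  | mul x y _ _ hx hy =>
    exact ⟨by rw [mul_assoc]; exact (hx (hy ht).1).1,
      by rw [← mul_assoc]; exact (hy (hx ht).2).2⟩

theorem card_lt_card_support_of_ne {ι κ : Type} [Fintype ι] [Fintype κ] (Z : κ ×ₗ ι → ℕ)
    (j : κ → ι) (hj : ∀ k, Z (toLex (k, j k)) ≠ 0) {k : κ} {i : ι} (hi : Z (toLex (k, i)) ≠ 0)
    (hne : i ≠ j k) : Fintype.card κ + 1 ≤ (Finset.univ.filter fun a => Z a ≠ 0).card := by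
  have hinj : Function.Injective fun o : Option κ =>
      o.elim (toLex (k, i)) fun l => toLex (l, j l) := by
    rintro (_ | a) (_ | b) h <;> simp_all
    grind
  rw [← Fintype.card_option, ← Finset.card_univ, ← Finset.card_image_of_injective _ hinj]
  refine Finset.card_le_card fun a ha => ?_
  simp only [Finset.mem_image, Finset.mem_univ, true_and, Finset.mem_filter] at ha ⊢
  obtain ⟨_ | l, rfl⟩ := ha
  · exact hi
  · exact hj l

theorem sortSum_sub_lexCongr_mem_Ysub {n p : ℕ} {ι ι' κ : Type} [LinearOrder ι] [Fintype ι]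
    [LinearOrder κ] [Fintype κ] [LinearOrder ι'] [Fintype ι'] (Z : κ ×ₗ ι → ℕ) (e : ι' ≃ ι)
    (hZ : ∀ k, ∑ i, Z (toLex (k, i)) ≠ 0) :
    sortSum n p Z - sortSum n p (Z ∘ lexCongr (Equiv.refl κ) e) ∈
      Ysub n p (Fintype.card κ + 1) := by
  have hex : ∀ k, ∃ i, Z (toLex (k, i)) ≠ 0 := fun k => by
    obtain ⟨i, -, hi⟩ := Finset.exists_ne_zero_of_sum_ne_zero (hZ k)
    exact ⟨i, hi⟩
  choose j hj using hex
  by_cases huniq : ∀ k i, Z (toLex (k, i)) ≠ 0 → i = j k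
  · have hmono : ∀ {α : Type} [LinearOrder α] (f : κ → α),
        StrictMono fun k => toLex (k, f k) := fun f a b hab =>
      Prod.Lex.toLex_lt_toLex.2 (Or.inl hab)
    rw [sortSum_eq_comp_strictMono Z _ (hmono j),
      sortSum_eq_comp_strictMono (Z ∘ lexCongr (Equiv.refl κ) e) _ (hmono fun k => e.symm (j k))]
    · have : (Z ∘ lexCongr (Equiv.refl κ) e) ∘ (fun k => toLex (k, e.symm (j k))) =
          Z ∘ fun k => toLex (k, j k) := by
        funext k
        simp [lexCongr]
      rw [this, sub_self]
      exact zero_mem _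
    · intro a ha
      refine ⟨(ofLex a).1, ?_⟩
      have h : e (ofLex a).2 = j (ofLex a).1 := huniq _ _ ha
      rw [← h, e.symm_apply_apply]
      rfl
    · intro a ha
      refine ⟨(ofLex a).1, ?_⟩
      rw [← huniq (ofLex a).1 (ofLex a).2 ha]
      rfl
  · push Not at huniq
    obtain ⟨k, i, hi, hne⟩ := huniq
    refine sub_mem (sortSum_mem_Ysub _ (card_lt_card_support_of_ne Z j hj hi hne))
      (sortSum_mem_Ysub _ (card_lt_card_support_of_ne _ (fun k => e.symm (j k)) ?_ (k := k)
        (i := e.symm i) ?_ (by simpa using hne)))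
    · intro k; simpa [lexCongr] using hj k
    · simpa [lexCongr] using hi

theorem Ysub_antitone (n p : ℕ) : Antitone (Ysub n p) := by
  intro a b hab
  refine Submodule.span_mono ?_
  rintro _ ⟨q, hq, rfl⟩
  exact ⟨q, hab.trans hq, rfl⟩

theorem Tsub_mul_Ysub {n p m : ℕ} {t y : GroupAlg n p} (ht : t ∈ Tsub n p)
    (hy : y ∈ Ysub n p m) : t * y ∈ Ysub n p (m + 1) := by
  induction hy using Submodule.span_induction with
  | mem y hy =>
    obtain ⟨s, hs, rfl⟩ := hy
    induction ht using Submodule.span_induction with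
    | mem t ht =>
      obtain ⟨q, r, hqr, rfl⟩ := ht
      obtain ⟨e, he⟩ := exists_blocksFun_comp_eq hqr
      have h := sortSum_comp_mul_sortSum_comp (n := n) (p := p) q.blocksFun s.blocksFun
        (Equiv.refl _) e
      rw [Equiv.coe_refl, Function.comp_id] at h
      rw [sub_mul, Bel_eq_sortSum, Bel_eq_sortSum, Bel_eq_sortSum, he, h, sortSum_mul_sortSum,
        ← Finset.sum_sub_distrib]
      refine Submodule.sum_mem _ fun Z hZ => Ysub_antitone n p (Nat.succ_le_succ hs) ?_
      have hpos : ∀ k, ∑ i, Z (toLex (k, i)) ≠ 0 := fun k => by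
        simp only [marginMatrices, Finset.mem_filter] at hZ
        rw [hZ.2.1 k]
        exact Nat.one_le_iff_ne_zero.1 (s.one_le_blocksFun k)
      have := sortSum_sub_lexCongr_mem_Ysub (n := n) (p := p) Z e hpos
      rwa [Fintype.card_fin] at this
    | zero => simp
    | add t u _ _ ht hu => rw [add_mul]; exact add_mem ht hu
    | smul c t _ ht => rw [smul_mul_assoc]; exact Submodule.smul_mem _ _ ht
  | zero => simp
  | add y u _ _ hy hu => rw [mul_add]; exact add_mem hy hu
  | smul c y _ hy => rw [mul_smul_comm]; exact Submodule.smul_mem _ _ hy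

theorem Tsub_le_Ysub_one {n p : ℕ} (hn : 1 ≤ n) : Tsub n p ≤ Ysub n p 1 := by
  refine Submodule.span_le.2 ?_
  rintro _ ⟨q, r, -, rfl⟩
  have h : ∀ q : Composition n, Bel n p q ∈ Ysub n p 1 := fun q =>
    Submodule.subset_span ⟨q, q.length_pos_iff.2 hn, rfl⟩
  exact sub_mem (h q) (h r)

theorem Ysub_eq_bot (n p : ℕ) : Ysub n p (n + 1) = ⊥ := by
  refine Submodule.span_eq_bot.2 ?_
  rintro _ ⟨q, hq, -⟩
  have := q.length_le
  omega

theorem list_prod_mem_Ysub {n p : ℕ} (hn : 1 ≤ n) (k : ℕ) (l : List (GroupAlg n p))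
    (hl : ∀ x ∈ l, x ∈ Tsub n p) (hk : l.length = k + 1) : l.prod ∈ Ysub n p (k + 1) := by
  induction k generalizing l with
  | zero =>
    obtain ⟨x, rfl⟩ := List.length_eq_one_iff.1 hk
    simpa using Tsub_le_Ysub_one hn (hl x (by simp))
  | succ k ih =>
    obtain _ | ⟨x, l⟩ := l
    · simp at hk
    · rw [List.prod_cons]
      exact Tsub_mul_Ysub (hl x (by simp))
        (ih l (fun y hy => hl y (by simp [hy])) (by simpa using hk))

theorem Tsub_list_prod_eq_zero {n p : ℕ} (hn : 1 ≤ n) (l : List (GroupAlg n p))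
    (hl : ∀ x ∈ l, x ∈ Tsub n p) (hk : l.length = n + 1) : l.prod = 0 := by
  have := list_prod_mem_Ysub hn n l hl hk
  rwa [Ysub_eq_bot, Submodule.mem_bot] at this

theorem mem_descentAlgebra_of_mem_Tsub {n p : ℕ} {t : GroupAlg n p} (ht : t ∈ Tsub n p) :
    t ∈ descentAlgebra n p := by
  have h : Tsub n p ≤ Subalgebra.toSubmodule (descentAlgebra n p) := by
    refine Submodule.span_le.2 ?_
    rintro _ ⟨q, r, -, rfl⟩
    exact sub_mem (BelS n p q).2 (BelS n p r).2
  exact h ht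

theorem Tsub_le_descentRadicalSubmodule {n p : ℕ} (hn : 1 ≤ n) :
    Tsub n p ≤ descentRadicalSubmodule n p := by
  intro t ht
  refine ⟨⟨t, mem_descentAlgebra_of_mem_Tsub ht⟩, ?_, rfl⟩
  refine Ideal.mem_jacobson_iff.2 fun y => ?_
  set x : descentAlgebra n p := ⟨t, mem_descentAlgebra_of_mem_Tsub ht⟩
  have hyx : ((y * x : descentAlgebra n p) : GroupAlg n p) ∈ Tsub n p := (mul_mem_Tsub y.2 ht).1
  have hnil : IsNilpotent (y * x) := by
    refine ⟨n + 1, Subtype.ext ?_⟩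
    have := Tsub_list_prod_eq_zero hn
      (List.replicate (n + 1) ((y * x : descentAlgebra n p) : GroupAlg n p))
      (fun z hz => by rw [List.eq_of_mem_replicate hz]; exact hyx) (by simp)
    rwa [List.prod_replicate] at this
  obtain ⟨u, hu⟩ := hnil.isUnit_one_add
  refine ⟨((u⁻¹ : (descentAlgebra n p)ˣ) : descentAlgebra n p), ?_⟩
  have h1 : ((u⁻¹ : (descentAlgebra n p)ˣ) : descentAlgebra n p) * (1 + y * x) = 1 := by
    rw [← hu, Units.inv_mul]
  rw [mul_add, mul_one] at h1
  rw [mul_assoc, Submodule.mem_bot, sub_eq_zero, add_comm]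
  exact h1

/-- The subspace `T` spanned by all differences `B̄_q - B̄_r` with `q ≈ r`
is a two-sided ideal of `Σ(n,p)`, is nilpotent, and is contained in `R(n,p)`. -/
theorem stmt19 (n p : ℕ) (hn : 1 ≤ n) (hp : p.Prime) :
    (∀ t ∈ Tsub n p, t ∈ descentAlgebra n p) ∧
    (∀ x ∈ descentAlgebra n p, ∀ t ∈ Tsub n p, x * t ∈ Tsub n p ∧ t * x ∈ Tsub n p) ∧
    (∃ k : ℕ, 0 < k ∧ ∀ l : List (GroupAlg n p),
      (∀ x ∈ l, x ∈ Tsub n p) → l.length = k → l.prod = 0) ∧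
    Tsub n p ≤ descentRadicalSubmodule n p := by
  exact ⟨fun t ht => mem_descentAlgebra_of_mem_Tsub ht, fun x hx t ht => mul_mem_Tsub hx ht,
    ⟨n + 1, n.succ_pos, Tsub_list_prod_eq_zero hn⟩, Tsub_le_descentRadicalSubmodule hn⟩

end
end
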